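/- Let 𝓛 ∈ ℝ^{(s+l)×(s+l)} be symmetric positive semidefinite with 𝓛·𝟙 = 0, partitioned in blocks as 𝓛 = [[𝓛_SS, 𝓛_SL],[𝓛_LS, 𝓛_LL]] with 𝓛_SS of size s×s and 𝓛_LL of size l×l, and suppose 𝓛_LL is invertible. Then the Schur complement 𝓛_red := 𝓛_SS − 𝓛_SL·𝓛_LL⁻¹·𝓛_LS is symmetric positive semidefinite and satisfies 𝓛_red·𝟙_s = 0, where 𝟙_s ∈ ℝ^s is the all-ones vector. -/

import Mathlib

open Matrix

/-- Kron reduction of a Laplacian is again a Laplacian-type matrix: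
if `𝓛 = [[A, B],[C, D]]` is symmetric PSD with zero row sums and `D = 𝓛_LL` is
invertible, then the Schur complement `A − B D⁻¹ C` is symmetric PSD with zero row
sums. -/
theorem kron_reduction_laplacian
    (s l : ℕ)
    (A : Matrix (Fin s) (Fin s) ℝ) (B : Matrix (Fin s) (Fin l) ℝ)
    (C : Matrix (Fin l) (Fin s) ℝ) (D : Matrix (Fin l) (Fin l) ℝ)
    (hpsd : (Matrix.fromBlocks A B C D).PosSemidef)
    (hones : Matrix.fromBlocks A B C D *ᵥ (fun _ => (1 : ℝ)) = 0)
    (hD : IsUnit D.det) :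
    (A - B * D⁻¹ * C).PosSemidef ∧
    (A - B * D⁻¹ * C) *ᵥ (fun _ => (1 : ℝ)) = 0 := by
  have hC : C = Bᴴ := by
    have h := (Matrix.isHermitian_fromBlocks_iff.mp hpsd.isHermitian).2.1
    exact h.symm
  subst hC
  have hDpsd : D.PosSemidef := hpsd.submatrix Sum.inr
  have hDpd : D.PosDef :=
    hDpsd.posDef_iff_isUnit.mpr ((Matrix.isUnit_iff_isUnit_det D).mpr hD)
  letI : Invertible D := Matrix.invertibleOfIsUnitDet D hD
  refine ⟨(Matrix.PosDef.fromBlocks₂₂ A B hDpd).mp hpsd, ?_⟩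
  have h1 : A *ᵥ (fun _ => (1 : ℝ)) + B *ᵥ (fun _ => (1 : ℝ)) = 0 := by
    ext i
    have := congrFun hones (Sum.inl i)
    simpa [Matrix.mulVec, dotProduct, Fintype.sum_sum_type] using this
  have h2 : Bᴴ *ᵥ (fun _ => (1 : ℝ)) + D *ᵥ (fun _ => (1 : ℝ)) = 0 := by
    ext i
    have := congrFun hones (Sum.inr i)
    simpa [Matrix.mulVec, dotProduct, Fintype.sum_sum_type] using this
  rw [Matrix.sub_mulVec, ← Matrix.mulVec_mulVec, eq_neg_of_add_eq_zero_left h2,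
    Matrix.mulVec_neg, Matrix.mulVec_mulVec, Matrix.mul_assoc, Matrix.nonsing_inv_mul D hD,
    Matrix.mul_one, sub_neg_eq_add, h1]
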